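/- Consider n unit-demand agents, m items with capacities k_j ≥ 1, and independent values v_ij ∼ F_ij (Borel distributions on ℝ_{≥0} with finite mean). The supremum of expected revenue over all dominant-strategy incentive compatible, individually rational deterministic mechanisms for the multi-agent unit-demand instance is at least 4/27 times the expected revenue of every dominant-strategy incentive compatible, individually rational deterministic mechanism for the copies instance. -/

import Mathlib

open MeasureTheory

/-- `S` is a matching: each agent `i` appears in at most one pair of `S` and
each item `j` appears in at most `k j` pairs of `S`. -/
def IsMatching (n m : ℕ) (k : Fin m → ℕ) (S : Finset (Fin n × Fin m)) : Prop :=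
  (∀ i : Fin n, (S.filter fun e => e.1 = i).card ≤ 1) ∧
  (∀ j : Fin m, (S.filter fun e => e.2 = j).card ≤ k j)

/-- `matchRank n m k S` is the maximum cardinality of a matching contained
in `S`. -/
noncomputable def matchRank (n m : ℕ) (k : Fin m → ℕ)
    (S : Finset (Fin n × Fin m)) : ℕ :=
  sSup {c : ℕ | ∃ M : Finset (Fin n × Fin m), M ⊆ S ∧ IsMatching n m k M ∧ M.card = c}

/-- The product distribution of the independent values `v i j ∼ F i j` on
valuation matrices. -/
noncomputable def valMeasure {n m : ℕ} (F : Fin n → Fin m → Measure ℝ) :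
    Measure (Fin n → Fin m → ℝ) :=
  Measure.pi fun i => Measure.pi fun j => F i j

/-- The valuation matrix obtained from `v` by changing entry `(i, j)` to `c`. -/
noncomputable def updateEntry {n m : ℕ} (v : Fin n → Fin m → ℝ) (i : Fin n)
    (j : Fin m) (c : ℝ) : Fin n → Fin m → ℝ :=
  Function.update v i (Function.update (v i) j c)

/-- A dominant-strategy IC, IR deterministic mechanism for the copies
instance: `X v` is the feasible set of served pseudo-agents (a matching) and
`pay v (i, j) ≥ 0` is the payment of pseudo-agent `(i, j)`. -/
structure IsCopiesMech (n m : ℕ) (k : Fin m → ℕ)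
    (X : (Fin n → Fin m → ℝ) → Finset (Fin n × Fin m))
    (pay : (Fin n → Fin m → ℝ) → Fin n × Fin m → ℝ) : Prop where
  feas : ∀ v, IsMatching n m k (X v)
  measX : ∀ S : Finset (Fin n × Fin m), MeasurableSet {v | X v = S}
  measPay : ∀ e : Fin n × Fin m, Measurable fun v => pay v e
  pay_nonneg : ∀ v e, 0 ≤ pay v e
  ic : ∀ v : Fin n → Fin m → ℝ, (∀ i j, 0 ≤ v i j) →
    ∀ (i : Fin n) (j : Fin m) (c : ℝ), 0 ≤ c →
      (if (i, j) ∈ X (updateEntry v i j c) then v i j else 0)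
          - pay (updateEntry v i j c) (i, j)
        ≤ (if (i, j) ∈ X v then v i j else 0) - pay v (i, j)
  ir : ∀ v : Fin n → Fin m → ℝ, (∀ i j, 0 ≤ v i j) → ∀ e : Fin n × Fin m,
    0 ≤ (if e ∈ X v then v e.1 e.2 else 0) - pay v e

/-- Expected revenue of a mechanism for the copies instance. -/
noncomputable def copiesRevenue {n m : ℕ} (F : Fin n → Fin m → Measure ℝ)
    (pay : (Fin n → Fin m → ℝ) → Fin n × Fin m → ℝ) : ℝ :=
  ∫ v, ∑ e : Fin n × Fin m, pay v e ∂(valMeasure F)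

/-- The utility of unit-demand agent `i` with values `v` when the mechanism
`(X, pay)` is run on the reported matrix `vhat`. -/
noncomputable def agentUtil {n m : ℕ}
    (X : (Fin n → Fin m → ℝ) → Finset (Fin n × Fin m))
    (pay : (Fin n → Fin m → ℝ) → Fin n → ℝ)
    (v vhat : Fin n → Fin m → ℝ) (i : Fin n) : ℝ :=
  (∑ j : Fin m, if (i, j) ∈ X vhat then v i j else 0) - pay vhat i

/-- A dominant-strategy IC, IR deterministic mechanism for the multi-agent
unit-demand instance: `X v` is a matching assigning items to agents and
`pay v i ≥ 0` is agent `i`'s payment. -/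
structure IsDetMech (n m : ℕ) (k : Fin m → ℕ)
    (X : (Fin n → Fin m → ℝ) → Finset (Fin n × Fin m))
    (pay : (Fin n → Fin m → ℝ) → Fin n → ℝ) : Prop where
  feas : ∀ v, IsMatching n m k (X v)
  measX : ∀ S : Finset (Fin n × Fin m), MeasurableSet {v | X v = S}
  measPay : ∀ i : Fin n, Measurable fun v => pay v i
  pay_nonneg : ∀ v i, 0 ≤ pay v i
  ic : ∀ v : Fin n → Fin m → ℝ, (∀ i j, 0 ≤ v i j) →
    ∀ (i : Fin n) (w : Fin m → ℝ), (∀ j, 0 ≤ w j) →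
      agentUtil X pay v (Function.update v i w) i ≤ agentUtil X pay v v i
  ir : ∀ v : Fin n → Fin m → ℝ, (∀ i j, 0 ≤ v i j) → ∀ i : Fin n,
    0 ≤ agentUtil X pay v v i

/-- Expected revenue of a deterministic multi-agent mechanism. -/
noncomputable def detRevenue {n m : ℕ} (F : Fin n → Fin m → Measure ℝ)
    (pay : (Fin n → Fin m → ℝ) → Fin n → ℝ) : ℝ :=
  ∫ v, ∑ i : Fin n, pay v i ∂(valMeasure F)

section MenuMechanism

variable {n m : ℕ}

/-- The pairs sharing the agent of `e` but not its item. -/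
def rowRivals (e : Fin n × Fin m) : Finset (Fin n × Fin m) :=
  Finset.univ.filter fun e' => e'.1 = e.1 ∧ e'.2 ≠ e.2

/-- The pairs sharing the item of `e` whose agent precedes that of `e`. -/
def colRivals (e : Fin n × Fin m) : Finset (Fin n × Fin m) :=
  Finset.univ.filter fun e' => e'.2 = e.2 ∧ e'.1 < e.1

/-- A family of incentive compatible, individually rational single-parameter sale rules, one for
each pair `e`: at value `t` the pair is served if `acc e t`, and pays `p e t`. -/
structure IsMenu (acc : Fin n × Fin m → ℝ → Prop) (p : Fin n × Fin m → ℝ → ℝ) : Prop where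
  measAcc : ∀ e, MeasurableSet {t | acc e t}
  measPay : ∀ e, Measurable (p e)
  nonneg : ∀ e t, 0 ≤ p e t
  ic : ∀ e t t', 0 ≤ t → 0 ≤ t' → acc e t' → acc e t → t - p e t' ≤ t - p e t
  ic_of_not : ∀ e t t', 0 ≤ t → 0 ≤ t' → acc e t' → ¬ acc e t → t - p e t' ≤ 0
  ir : ∀ e t, 0 ≤ t → acc e t → 0 ≤ t - p e t
  pay_of_not : ∀ e t, ¬ acc e t → p e t = 0

variable (k : Fin m → ℕ) (acc : Fin n × Fin m → ℝ → Prop) (p : Fin n × Fin m → ℝ → ℝ)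

open Classical in
/-- Pair `e` may trade at `v`: it accepts, and fewer than `k e.2` earlier agents accept the item. -/
def Eligible (v : Fin n → Fin m → ℝ) (e : Fin n × Fin m) : Prop :=
  acc e (v e.1 e.2) ∧ ((colRivals e).filter fun e' => acc e' (v e'.1 e'.2)).card < k e.2

open Classical in
/-- Every agent receives its favourite eligible item, ties going to the smallest index. -/
noncomputable def menuAlloc (v : Fin n → Fin m → ℝ) : Finset (Fin n × Fin m) :=
  Finset.univ.filter fun e => Eligible k acc v e ∧ ∀ j, Eligible k acc v (e.1, j) →
    v e.1 j - p (e.1, j) (v e.1 j) < v e.1 e.2 - p e (v e.1 e.2) ∨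
    (v e.1 j - p (e.1, j) (v e.1 j) = v e.1 e.2 - p e (v e.1 e.2) ∧ e.2 ≤ j)

/-- Every agent pays the price of the item it receives. -/
noncomputable def menuPay (v : Fin n → Fin m → ℝ) (i : Fin n) : ℝ :=
  ∑ j, if (i, j) ∈ menuAlloc k acc p v then p (i, j) (v i j) else 0

variable {k acc p}

lemma mem_menuAlloc {v : Fin n → Fin m → ℝ} {i : Fin n} {j : Fin m} :
    (i, j) ∈ menuAlloc k acc p v ↔ Eligible k acc v (i, j) ∧ ∀ j', Eligible k acc v (i, j') →
      v i j' - p (i, j') (v i j') < v i j - p (i, j) (v i j) ∨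
      (v i j' - p (i, j') (v i j') = v i j - p (i, j) (v i j) ∧ j ≤ j') := by
  simp [menuAlloc]

lemma menuAlloc_unique {v : Fin n → Fin m → ℝ} {i : Fin n} {j j' : Fin m}
    (h : (i, j) ∈ menuAlloc k acc p v) (h' : (i, j') ∈ menuAlloc k acc p v) : j = j' := by
  rw [mem_menuAlloc] at h h'
  rcases h.2 j' h'.1 with h1 | ⟨h1, h1'⟩ <;> rcases h'.2 j h.1 with h2 | ⟨h2, h2'⟩
  · linarith
  · linarith
  · linarith
  · exact le_antisymm h1' h2'

lemma exists_mem_menuAlloc {v : Fin n → Fin m → ℝ} {i : Fin n} {j₀ : Fin m}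
    (h₀ : Eligible k acc v (i, j₀)) : ∃ j, (i, j) ∈ menuAlloc k acc p v := by
  classical
  obtain ⟨j₁, hj₁, hmax⟩ := (Finset.univ.filter fun j => Eligible k acc v (i, j)).exists_max_image
    (fun j => v i j - p (i, j) (v i j)) ⟨j₀, by simpa using h₀⟩
  simp only [Finset.mem_filter, Finset.mem_univ, true_and] at hj₁ hmax
  obtain ⟨j, hj, hmin⟩ := (Finset.univ.filter fun j => Eligible k acc v (i, j) ∧
    v i j - p (i, j) (v i j) = v i j₁ - p (i, j₁) (v i j₁)).exists_min_image id
    ⟨j₁, by simpa using hj₁⟩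
  simp only [Finset.mem_filter, Finset.mem_univ, true_and, id] at hj hmin
  refine ⟨j, mem_menuAlloc.2 ⟨hj.1, fun j' hj' => ?_⟩⟩
  rcases (hmax j' hj').lt_or_eq with h | h
  · left; rw [hj.2]; exact h
  · right; exact ⟨h.trans hj.2.symm, hmin j' ⟨hj', h⟩⟩

lemma menuAlloc_isMatching (v : Fin n → Fin m → ℝ) :
    IsMatching n m k (menuAlloc k acc p v) := by
  classical
  refine ⟨fun i => Finset.card_le_one.2 ?_, fun j => ?_⟩
  · rintro ⟨i₁, j₁⟩ h₁ ⟨i₂, j₂⟩ h₂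
    simp only [Finset.mem_filter] at h₁ h₂
    obtain ⟨h₁, rfl⟩ := h₁
    obtain ⟨h₂, rfl⟩ := h₂
    rw [menuAlloc_unique h₁ h₂]
  · rcases ((menuAlloc k acc p v).filter fun e => e.2 = j).eq_empty_or_nonempty with h | h
    · simp [h]
    obtain ⟨⟨i, j'⟩, he, hmax⟩ := Finset.exists_max_image _ Prod.fst h
    simp only [Finset.mem_filter] at he hmax
    obtain ⟨he, rfl⟩ := he
    rw [mem_menuAlloc] at he
    have hsub : ((menuAlloc k acc p v).filter fun e => e.2 = j').erase (i, j') ⊆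
        (colRivals (i, j')).filter fun e' => acc e' (v e'.1 e'.2) := by
      rintro ⟨i₁, j₁⟩ h₁
      simp only [Finset.mem_erase, Finset.mem_filter] at h₁
      obtain ⟨hne, h₁, rfl⟩ := h₁
      have hle := hmax _ ⟨h₁, rfl⟩
      have hne' : i₁ ≠ i := fun h => hne (by rw [h])
      simp only [colRivals, Finset.mem_filter, Finset.mem_univ, true_and]
      exact ⟨lt_of_le_of_ne hle hne', (mem_menuAlloc.1 h₁).1.1⟩
    have := (Finset.card_le_card hsub).trans_lt he.1.2
    have h2 := Finset.pred_card_le_card_erase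
      (s := (menuAlloc k acc p v).filter fun e => e.2 = j') (a := (i, j'))
    simp only at this
    omega

lemma measurableSet_eligible (h : IsMenu acc p) (e : Fin n × Fin m) :
    MeasurableSet {v | Eligible k acc v e} := by
  classical
  have hacc : ∀ e : Fin n × Fin m,
      MeasurableSet {v : Fin n → Fin m → ℝ | acc e (v e.1 e.2)} := fun e =>
    (show Measurable fun v : Fin n → Fin m → ℝ => v e.1 e.2 by fun_prop) (h.measAcc e)
  have hcard : Measurable fun v : Fin n → Fin m → ℝ =>
      ((colRivals e).filter fun e' => acc e' (v e'.1 e'.2)).card := by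
    simp only [Finset.card_filter]
    exact Finset.measurable_sum _ fun e' _ =>
      Measurable.ite (hacc e') measurable_const measurable_const
  exact (hacc e).inter (hcard (measurableSet_Iio (a := k e.2)))

lemma measurableSet_mem_menuAlloc (h : IsMenu acc p) (e : Fin n × Fin m) :
    MeasurableSet {v | e ∈ menuAlloc k acc p v} := by
  obtain ⟨i, j⟩ := e
  have hu : ∀ j, Measurable fun v : Fin n → Fin m → ℝ => v i j - p (i, j) (v i j) := fun j =>
    have hv : Measurable fun v : Fin n → Fin m → ℝ => v i j := by fun_prop
    hv.sub ((h.measPay _).comp hv)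
  simp only [mem_menuAlloc, Set.ofPred_and, Set.ofPred_forall]
  refine (measurableSet_eligible h _).inter (MeasurableSet.iInter fun j' => ?_)
  simp only [imp_iff_not_or, Set.ofPred_or, Set.ofPred_and]
  exact (measurableSet_eligible h _).compl.union
    ((measurableSet_lt (hu j') (hu j)).union
      ((measurableSet_eq_fun (hu j') (hu j)).inter (MeasurableSet.const _)))

lemma measurable_menuPay (h : IsMenu acc p) (i : Fin n) :
    Measurable fun v => menuPay k acc p v i :=
  Finset.measurable_sum _ fun j _ => Measurable.ite (measurableSet_mem_menuAlloc h _)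
    ((h.measPay _).comp (by fun_prop)) measurable_const

lemma agentUtil_of_mem {v w : Fin n → Fin m → ℝ} {i : Fin n} {j : Fin m}
    (hj : (i, j) ∈ menuAlloc k acc p w) :
    agentUtil (menuAlloc k acc p) (menuPay k acc p) v w i = v i j - p (i, j) (w i j) := by
  have key : ∀ f : Fin m → ℝ, (∑ j', if (i, j') ∈ menuAlloc k acc p w then f j' else 0) = f j := by
    intro f
    rw [Finset.sum_eq_single j (fun j' _ hne => if_neg fun h => hne (menuAlloc_unique h hj))
      (by simp), if_pos hj]
  rw [agentUtil, menuPay, key (fun j => v i j), key (fun j => p (i, j) (w i j))]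

lemma agentUtil_of_forall_notMem {v w : Fin n → Fin m → ℝ} {i : Fin n}
    (h : ∀ j, (i, j) ∉ menuAlloc k acc p w) :
    agentUtil (menuAlloc k acc p) (menuPay k acc p) v w i = 0 := by
  simp [agentUtil, menuPay, h]

lemma agentUtil_menu_nonneg (h : IsMenu acc p) {v : Fin n → Fin m → ℝ} (hv : ∀ i j, 0 ≤ v i j)
    (i : Fin n) : 0 ≤ agentUtil (menuAlloc k acc p) (menuPay k acc p) v v i := by
  by_cases hj : ∃ j, (i, j) ∈ menuAlloc k acc p v
  · obtain ⟨j, hj⟩ := hj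
    rw [agentUtil_of_mem hj]
    exact h.ir _ _ (hv i j) (mem_menuAlloc.1 hj).1.1
  · exact (agentUtil_of_forall_notMem (not_exists.1 hj)).ge

lemma le_agentUtil_of_eligible {v : Fin n → Fin m → ℝ} {i : Fin n} {j : Fin m}
    (hj : Eligible k acc v (i, j)) :
    v i j - p (i, j) (v i j) ≤ agentUtil (menuAlloc k acc p) (menuPay k acc p) v v i := by
  obtain ⟨j', hj'⟩ := exists_mem_menuAlloc (p := p) hj
  rw [agentUtil_of_mem hj']
  rcases (mem_menuAlloc.1 hj').2 j hj with h | h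
  · exact h.le
  · exact h.1.le

/-- Selling through a menu with a first-come-first-served capacity rule is incentive compatible. -/
theorem IsMenu.isDetMech (h : IsMenu acc p) :
    IsDetMech n m k (menuAlloc k acc p) (menuPay k acc p) where
  feas := menuAlloc_isMatching
  measX S := by
    have : {v | menuAlloc k acc p v = S} = ⋂ e, {v | e ∈ menuAlloc k acc p v ↔ e ∈ S} := by
      ext v; simp [Finset.ext_iff]
    rw [this]
    refine MeasurableSet.iInter fun e => ?_
    by_cases he : e ∈ S
    · simpa [he] using measurableSet_mem_menuAlloc h e
    · simp only [he, iff_false]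
      exact (measurableSet_mem_menuAlloc h e).compl
  measPay := measurable_menuPay h
  pay_nonneg v i := Finset.sum_nonneg fun j _ => by
    split_ifs
    · exact h.nonneg _ _
    · exact le_rfl
  ir v hv i := agentUtil_menu_nonneg h hv i
  ic v hv i w hw := by
    by_cases hj : ∃ j, (i, j) ∈ menuAlloc k acc p (Function.update v i w)
    · obtain ⟨j, hj⟩ := hj
      rw [agentUtil_of_mem hj, Function.update_self]
      obtain ⟨hacc, hcap⟩ := (mem_menuAlloc.1 hj).1
      rw [Function.update_self] at hacc
      by_cases hv_acc : acc (i, j) (v i j)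
      · refine (h.ic _ _ _ (hv i j) (hw j) hacc hv_acc).trans
          (le_agentUtil_of_eligible ⟨hv_acc, ?_⟩)
        refine lt_of_le_of_lt (Finset.card_le_card fun e he => ?_) hcap
        simp only [Finset.mem_filter] at he ⊢
        have hne : e.1 ≠ i := by
          have := he.1
          simp only [colRivals, Finset.mem_filter] at this
          exact this.2.2.ne
        rwa [Function.update_of_ne hne]
      · exact (h.ic_of_not _ _ _ (hv i j) (hw j) hacc hv_acc).trans (agentUtil_menu_nonneg h hv i)
    · rw [agentUtil_of_forall_notMem (not_exists.1 hj)]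
      exact agentUtil_menu_nonneg h hv i

open Classical in
/-- A pair pays its price as soon as no row rival accepts and capacity is left over by the column
rivals. -/
lemma sum_price_mul_le_sum_menuPay (h : IsMenu acc p) (v : Fin n → Fin m → ℝ) :
    ∑ e : Fin n × Fin m, p e (v e.1 e.2) *
      ((if ∑ e' ∈ rowRivals e, (if acc e' (v e'.1 e'.2) then (1 : ℝ) else 0) < 1 then 1 else 0) *
      (if ∑ e' ∈ colRivals e, (if acc e' (v e'.1 e'.2) then (1 : ℝ) else 0) < k e.2 then 1 else 0))
      ≤ ∑ i, menuPay k acc p v i := by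
  simp only [menuPay]
  rw [← Fintype.sum_prod_type' (f := fun i j =>
    if (i, j) ∈ menuAlloc k acc p v then p (i, j) (v i j) else 0)]
  refine Finset.sum_le_sum fun e _ => ?_
  obtain ⟨i, j⟩ := e
  simp only [Finset.sum_boole]
  have hp := h.nonneg (i, j) (v i j)
  by_cases hacc : acc (i, j) (v i j)
  swap
  · simp [h.pay_of_not _ _ hacc]
  split_ifs with h1 h2 h3 <;> simp only [mul_one, mul_zero, le_refl, hp]
  refine absurd (mem_menuAlloc.2 ⟨⟨hacc, by exact_mod_cast h2⟩, fun j' hj' => ?_⟩) h3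
  right
  have h1' : ((rowRivals (i, j)).filter fun e' => acc e' (v e'.1 e'.2)).card = 0 := by
    have : ((rowRivals (i, j)).filter fun e' => acc e' (v e'.1 e'.2)).card < 1 := by
      exact_mod_cast h1
    omega
  rw [Finset.card_eq_zero, Finset.filter_eq_empty_iff] at h1'
  have hjj : j' = j := by
    by_contra hne
    exact h1' (x := (i, j')) (by simp [rowRivals, hne]) hj'.1
  subst hjj
  exact ⟨rfl, le_rfl⟩

end MenuMechanism

section ProductMeasures

open ProbabilityTheory

lemma measurePreserving_update {ι : Type*} [Fintype ι] [DecidableEq ι] {α : ι → Type*}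
    [∀ i, MeasurableSpace (α i)] (μ : ∀ i, Measure (α i)) [∀ i, IsProbabilityMeasure (μ i)]
    (i : ι) :
    MeasurePreserving (fun z : α i × (∀ j, α j) => Function.update z.2 i z.1)
      ((μ i).prod (Measure.pi μ)) (Measure.pi μ) := by
  have hmeas : Measurable fun z : α i × (∀ j, α j) => Function.update z.2 i z.1 :=
    measurable_update'.comp measurable_swap
  refine ⟨hmeas, (Measure.pi_eq fun s hs => ?_).symm⟩
  have hpre : (fun z : α i × (∀ j, α j) => Function.update z.2 i z.1) ⁻¹' Set.univ.pi s =
      s i ×ˢ Set.univ.pi (Function.update s i Set.univ) := by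
    ext z
    simp only [Set.mem_preimage, Set.mem_pi, Set.mem_univ, true_imp_iff, Set.mem_prod]
    refine ⟨fun h => ⟨by simpa using h i, fun j => ?_⟩, fun h j => ?_⟩
    · rcases eq_or_ne j i with rfl | hj
      · simp
      · simpa [hj] using h j
    · rcases eq_or_ne j i with rfl | hj
      · simpa using h.1
      · simpa [hj] using h.2 j
  rw [Measure.map_apply hmeas (MeasurableSet.univ_pi hs), hpre, Measure.prod_prod, Measure.pi_pi,
    ← Finset.mul_prod_erase Finset.univ (fun j => μ j (s j)) (Finset.mem_univ i),
    ← Finset.mul_prod_erase Finset.univ (fun j => μ j (Function.update s i Set.univ j))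
      (Finset.mem_univ i)]
  simp only [Function.update_self, measure_univ, one_mul]
  congr 1
  refine Finset.prod_congr rfl fun j hj => ?_
  rw [Function.update_of_ne (Finset.ne_of_mem_erase hj)]

lemma measurePreserving_resample {ι : Type*} [Fintype ι] [DecidableEq ι] {κ : Type*}
    [MeasurableSpace κ] (μ : ι → Measure ℝ) [∀ i, IsProbabilityMeasure (μ i)]
    (ν : Measure κ) [IsProbabilityMeasure ν] :
    MeasurePreserving
      (fun (z : (ι → ℝ) × (ι → (ι → ℝ) × κ)) i =>
        (Function.update (z.2 i).1 i (z.1 i), (z.2 i).2))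
      ((Measure.pi μ).prod (Measure.pi fun _ => (Measure.pi μ).prod ν))
      (Measure.pi fun _ => (Measure.pi μ).prod ν) := by
  have h1 := (measurePreserving_arrowProdEquivProdArrow ℝ ((ι → ℝ) × κ) ι μ
    (fun _ => (Measure.pi μ).prod ν)).symm
  have h2 : ∀ i, MeasurePreserving
      (fun z : ℝ × (ι → ℝ) × κ => (Function.update z.2.1 i z.1, z.2.2))
      ((μ i).prod ((Measure.pi μ).prod ν)) ((Measure.pi μ).prod ν) := fun i =>
    ((measurePreserving_update μ i).prod (MeasurePreserving.id ν)).comp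
      (measurePreserving_prodAssoc (μ i) (Measure.pi μ) ν).symm
  exact (measurePreserving_pi _ _ h2).comp h1

lemma measurePreserving_curry {n m : ℕ} (F : Fin n → Fin m → Measure ℝ)
    [∀ i j, IsProbabilityMeasure (F i j)] :
    MeasurePreserving (fun (x : Fin n × Fin m → ℝ) i j => x (i, j))
      (Measure.pi fun e : Fin n × Fin m => F e.1 e.2) (valMeasure F) := by
  have hc : Measurable fun (x : Fin n × Fin m → ℝ) i j => x (i, j) := by fun_prop
  have hu : Measurable fun (v : Fin n → Fin m → ℝ) (e : Fin n × Fin m) => v e.1 e.2 := by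
    fun_prop
  have h : (valMeasure F).map (fun v (e : Fin n × Fin m) => v e.1 e.2) =
      Measure.pi fun e : Fin n × Fin m => F e.1 e.2 := by
    refine (Measure.pi_eq fun s hs => ?_).symm
    have hpre : (fun (v : Fin n → Fin m → ℝ) (e : Fin n × Fin m) => v e.1 e.2) ⁻¹'
        Set.univ.pi s = Set.univ.pi fun i => Set.univ.pi fun j => s (i, j) := by
      ext v; simp [Set.mem_pi]
    rw [Measure.map_apply hu (MeasurableSet.univ_pi hs), hpre, valMeasure, Measure.pi_pi,
      Fintype.prod_prod_type]
    simp only [Measure.pi_pi]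
  refine ⟨hc, ?_⟩
  rw [← h, Measure.map_map hc hu]
  exact Measure.map_id

variable {ι α : Type*} [Fintype ι] [MeasurableSpace α]
  (ρ : ι → Measure α) [∀ i, IsProbabilityMeasure (ρ i)]

lemma integral_mul_of_disjoint_blocks [DecidableEq ι] {f : ι → α → ℝ}
    (hf : ∀ i, Measurable (f i)) {h : α → ℝ}
    (hh : Measurable h) {φ ψ : ℝ → ℝ} (hφ : Measurable φ) (hψ : Measurable ψ) {e : ι}
    {S T : Finset ι} (heS : e ∉ S) (heT : e ∉ T) (hST : Disjoint S T) :
    ∫ ω, h (ω e) * (φ (∑ i ∈ S, f i (ω i)) * ψ (∑ i ∈ T, f i (ω i))) ∂(Measure.pi ρ) =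
      (∫ x, h x ∂(ρ e)) * ((∫ ω, φ (∑ i ∈ S, f i (ω i)) ∂(Measure.pi ρ)) *
        ∫ ω, ψ (∑ i ∈ T, f i (ω i)) ∂(Measure.pi ρ)) := by
  have hind : iIndepFun (fun i (ω : ι → α) => ω i) (Measure.pi ρ) :=
    iIndepFun_pi (X := fun _ => id) fun _ => measurable_id.aemeasurable
  have hm : ∀ i, Measurable fun ω : ι → α => ω i := measurable_pi_apply
  have hsum : ∀ S : Finset ι, Measurable fun ω : ι → α => ∑ i ∈ S, f i (ω i) := fun S =>
    Finset.measurable_sum _ fun i _ => (hf i).comp (hm i)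
  have hblock : ∀ S : Finset ι, Measurable fun y : S → α => ∑ i : S, f i (y i) := fun S =>
    Finset.measurable_sum _ fun i _ => (hf i).comp (measurable_pi_apply i)
  have h1 : IndepFun (fun ω : ι → α => φ (∑ i ∈ S, f i (ω i)))
      (fun ω => ψ (∑ i ∈ T, f i (ω i))) (Measure.pi ρ) := by
    have := (hind.indepFun_finset S T hST hm).comp (hφ.comp (hblock S)) (hψ.comp (hblock T))
    convert this using 1 <;> ext ω <;> simp only [Function.comp]
    · rw [← Finset.sum_coe_sort S fun i => f i (ω i)]
    · rw [← Finset.sum_coe_sort T fun i => f i (ω i)]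
  have h2 : IndepFun (fun ω : ι → α => h (ω e))
      (fun ω => φ (∑ i ∈ S, f i (ω i)) * ψ (∑ i ∈ T, f i (ω i))) (Measure.pi ρ) := by
    have hdis : Disjoint {e} (S ∪ T) := by simp [heS, heT]
    have hpart : ∀ R : Finset ι, Measurable fun y : (S ∪ T : Finset ι) → α =>
        ∑ i : (S ∪ T : Finset ι), if (i : ι) ∈ R then f i (y i) else 0 := fun R =>
      Finset.measurable_sum _ fun i _ =>
        Measurable.ite (MeasurableSet.const _) ((hf i).comp (measurable_pi_apply i))
          measurable_const
    have := (hind.indepFun_finset {e} (S ∪ T) hdis hm).comp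
      (hh.comp (measurable_pi_apply (⟨e, by simp⟩ : ({e} : Finset ι))))
      ((hφ.comp (hpart S)).mul (hψ.comp (hpart T)))
    have hres : ∀ R ⊆ S ∪ T, ∀ ω : ι → α,
        (∑ i : (S ∪ T : Finset ι), if (i : ι) ∈ R then f i (ω i) else 0) =
          ∑ i ∈ R, f i (ω i) := fun R hR ω => by
      rw [Finset.sum_coe_sort (S ∪ T) fun i => if i ∈ R then f i (ω i) else 0,
        Finset.sum_ite_mem, Finset.inter_eq_right.2 hR]
    convert this using 1
    · rfl
    · funext ω
      change _ = φ (∑ i : (S ∪ T : Finset ι), if (i : ι) ∈ S then f i (ω i) else 0) *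
        ψ (∑ i : (S ∪ T : Finset ι), if (i : ι) ∈ T then f i (ω i) else 0)
      rw [hres S Finset.subset_union_left, hres T Finset.subset_union_right]
  have e2 := h2.integral_mul_eq_mul_integral (hh.comp (hm e)).aestronglyMeasurable
    ((hφ.comp (hsum S)).mul (hψ.comp (hsum T))).aestronglyMeasurable
  have e1 := h1.integral_mul_eq_mul_integral (hφ.comp (hsum S)).aestronglyMeasurable
    (hψ.comp (hsum T)).aestronglyMeasurable
  simp only [Pi.mul_apply] at e1 e2
  have e0 : ∫ ω, h (ω e) ∂(Measure.pi ρ) = ∫ x, h x ∂(ρ e) := by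
    have hp := measurePreserving_eval ρ e
    rw [← hp.map_eq, integral_map hp.measurable.aemeasurable hh.aestronglyMeasurable]
  calc _ = _ := e2
    _ = _ := by rw [e0]; congr 1

lemma two_thirds_le_integral_sum_lt {f : ι → α → ℝ} (hf : ∀ i, Measurable (f i))
    (hf0 : ∀ i x, 0 ≤ f i x) (hf1 : ∀ i x, f i x ≤ 1) {S : Finset ι} {c : ℝ} (hc : 0 < c)
    (hS : ∑ i ∈ S, ∫ x, f i x ∂(ρ i) ≤ c / 3) :
    2 / 3 ≤ ∫ ω, (if ∑ i ∈ S, f i (ω i) < c then (1 : ℝ) else 0) ∂(Measure.pi ρ) := by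
  have hm : ∀ i, Measurable fun ω : ι → α => f i (ω i) := fun i =>
    (hf i).comp (measurable_pi_apply i)
  have hInt : ∀ i, Integrable (fun ω : ι → α => f i (ω i)) (Measure.pi ρ) := fun i =>
    Integrable.of_bound (hm i).aestronglyMeasurable 1 (ae_of_all _ fun ω => by
      rw [Real.norm_of_nonneg (hf0 _ _)]; exact hf1 _ _)
  have hsum : Measurable fun ω : ι → α => ∑ i ∈ S, f i (ω i) :=
    Finset.measurable_sum _ fun i _ => hm i
  have hsumint : Integrable (fun ω : ι → α => ∑ i ∈ S, f i (ω i)) (Measure.pi ρ) :=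
    integrable_finsetSum _ fun i _ => hInt i
  have heval : ∫ ω, ∑ i ∈ S, f i (ω i) ∂(Measure.pi ρ) = ∑ i ∈ S, ∫ x, f i x ∂(ρ i) := by
    rw [integral_finsetSum _ fun i _ => hInt i]
    refine Finset.sum_congr rfl fun i _ => ?_
    have hp := measurePreserving_eval ρ i
    rw [← hp.map_eq, integral_map hp.measurable.aemeasurable (hf i).aestronglyMeasurable]
  calc (2 : ℝ) / 3 ≤ 1 - (∑ i ∈ S, ∫ x, f i x ∂(ρ i)) / c := by
        have : (∑ i ∈ S, ∫ x, f i x ∂(ρ i)) / c ≤ 1 / 3 := by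
          rw [div_le_iff₀ hc]; linarith
        linarith
    _ = ∫ ω, (1 - (∑ i ∈ S, f i (ω i)) / c) ∂(Measure.pi ρ) := by
        rw [integral_sub (integrable_const _) (hsumint.div_const c), integral_div, heval]
        simp
    _ ≤ _ := by
        refine integral_mono ((integrable_const _).sub (hsumint.div_const c)) ?_ fun ω => ?_
        · exact Integrable.of_bound (Measurable.ite (measurableSet_lt hsum measurable_const)
            measurable_const measurable_const).aestronglyMeasurable 1 (ae_of_all _ fun ω => by
              split_ifs <;> simp)
        · have h0 : 0 ≤ ∑ i ∈ S, f i (ω i) := Finset.sum_nonneg fun i _ => hf0 _ _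
          dsimp only
          split_ifs with h
          · have := div_nonneg h0 hc.le; linarith
          · have : 1 ≤ (∑ i ∈ S, f i (ω i)) / c := by
              rw [le_div_iff₀ hc]; linarith
            linarith

end ProductMeasures

section Resampling

open ProbabilityTheory

variable {n m : ℕ} {k : Fin m → ℕ}

lemma ae_valMeasure_nonneg (F : Fin n → Fin m → Measure ℝ) [∀ i j, IsProbabilityMeasure (F i j)]
    (hF : ∀ i j, F i j (Set.Iio 0) = 0) : ∀ᵐ v ∂(valMeasure F), ∀ i j, 0 ≤ v i j := by
  rw [ae_all_iff]; intro i
  rw [ae_all_iff]; intro j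
  have hp : MeasurePreserving (fun v : Fin n → Fin m → ℝ => v i j) (valMeasure F) (F i j) :=
    (measurePreserving_eval (F i) j).comp
      (measurePreserving_eval (fun i => Measure.pi fun j => F i j) i)
  refine hp.quasiMeasurePreserving.ae (p := fun t => 0 ≤ t) ?_
  rw [ae_iff]
  convert hF i j using 2
  ext t; simp

lemma integrable_valMeasure_entry (F : Fin n → Fin m → Measure ℝ)
    [∀ i j, IsProbabilityMeasure (F i j)] (hF : ∀ i j, Integrable id (F i j)) (i : Fin n)
    (j : Fin m) : Integrable (fun v => v i j) (valMeasure F) := by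
  have hp : MeasurePreserving (fun v : Fin n → Fin m → ℝ => v i j) (valMeasure F) (F i j) :=
    (measurePreserving_eval (F i) j).comp
      (measurePreserving_eval (fun i => Measure.pi fun j => F i j) i)
  exact hp.integrable_comp_of_integrable (hF i j)

lemma IsDetMech.sum_pay_le {X : (Fin n → Fin m → ℝ) → Finset (Fin n × Fin m)}
    {pay : (Fin n → Fin m → ℝ) → Fin n → ℝ} (h : IsDetMech n m k X pay)
    {v : Fin n → Fin m → ℝ} (hv : ∀ i j, 0 ≤ v i j) :
    ∑ i, pay v i ≤ ∑ i, ∑ j, v i j := by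
  refine Finset.sum_le_sum fun i _ => ?_
  have h1 := h.ir v hv i
  rw [agentUtil] at h1
  refine (sub_nonneg.1 h1).trans (Finset.sum_le_sum fun j _ => ?_)
  split_ifs
  · exact le_rfl
  · exact hv i j

lemma integrable_sum_entries (F : Fin n → Fin m → Measure ℝ)
    [∀ i j, IsProbabilityMeasure (F i j)] (hF : ∀ i j, Integrable id (F i j)) :
    Integrable (fun v => ∑ i, ∑ j, v i j) (valMeasure F) :=
  integrable_finsetSum _ fun i _ => integrable_finsetSum _ fun j _ =>
    integrable_valMeasure_entry F hF i j

lemma IsDetMech.integrable {F : Fin n → Fin m → Measure ℝ}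
    [∀ i j, IsProbabilityMeasure (F i j)] (hF0 : ∀ i j, F i j (Set.Iio 0) = 0)
    (hF : ∀ i j, Integrable id (F i j))
    {X : (Fin n → Fin m → ℝ) → Finset (Fin n × Fin m)}
    {pay : (Fin n → Fin m → ℝ) → Fin n → ℝ} (h : IsDetMech n m k X pay) :
    Integrable (fun v => ∑ i, pay v i) (valMeasure F) := by
  refine (integrable_sum_entries F hF).mono'
    (Finset.measurable_sum _ fun i _ => h.measPay i).aestronglyMeasurable ?_
  filter_upwards [ae_valMeasure_nonneg F hF0] with v hv
  rw [Real.norm_of_nonneg (Finset.sum_nonneg fun i _ => h.pay_nonneg v i)]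
  exact h.sum_pay_le hv

lemma bddAbove_detRevenue {F : Fin n → Fin m → Measure ℝ}
    [∀ i j, IsProbabilityMeasure (F i j)] (hF0 : ∀ i j, F i j (Set.Iio 0) = 0)
    (hF : ∀ i j, Integrable id (F i j)) :
    BddAbove {r : ℝ | ∃ (X' : (Fin n → Fin m → ℝ) → Finset (Fin n × Fin m))
      (pay' : (Fin n → Fin m → ℝ) → Fin n → ℝ),
      IsDetMech n m k X' pay' ∧ r = detRevenue F pay'} := by
  refine ⟨∫ v, ∑ i, ∑ j, v i j ∂(valMeasure F), ?_⟩
  rintro r ⟨X, pay, h, rfl⟩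
  refine integral_mono_ae (h.integrable hF0 hF) (integrable_sum_entries F hF) ?_
  filter_upwards [ae_valMeasure_nonneg F hF0] with v hv
  exact h.sum_pay_le hv

/-- The valuation matrix of absolute values of a flat vector of values. -/
def absMatrix (x : Fin n × Fin m → ℝ) : Fin n → Fin m → ℝ := fun i j => |x (i, j)|

lemma absMatrix_nonneg (x : Fin n × Fin m → ℝ) (i : Fin n) (j : Fin m) : 0 ≤ absMatrix x i j :=
  abs_nonneg _

lemma measurable_absMatrix : Measurable (absMatrix : (Fin n × Fin m → ℝ) → _) :=
  measurable_pi_lambda _ fun _ => measurable_pi_lambda _ fun _ => (measurable_pi_apply _).abs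

lemma updateEntry_absMatrix_update (x : Fin n × Fin m → ℝ) (e : Fin n × Fin m) (t : ℝ) {t' : ℝ}
    (ht' : 0 ≤ t') :
    updateEntry (absMatrix (Function.update x e t)) e.1 e.2 t' =
      absMatrix (Function.update x e t') := by
  obtain ⟨a, b⟩ := e
  funext i j
  by_cases hi : i = a <;> by_cases hj : j = b <;>
    simp [updateEntry, absMatrix, hi, hj, abs_of_nonneg ht']

lemma absMatrix_update_apply (x : Fin n × Fin m → ℝ) (e : Fin n × Fin m) {t : ℝ} (ht : 0 ≤ t) :
    absMatrix (Function.update x e t) e.1 e.2 = t := by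
  simp [absMatrix, abs_of_nonneg ht]

/-- Pair `e` is served by the copies allocation `X` at the sampled values and its coin is `0`. -/
def Served (X : (Fin n → Fin m → ℝ) → Finset (Fin n × Fin m)) (e : Fin n × Fin m)
    (s : (Fin n × Fin m → ℝ) × Fin 3) : Prop :=
  s.2 = 0 ∧ e ∈ X (absMatrix s.1)

/-- The copies payment of pair `e` at the sampled values, charged only if its coin is `0`. -/
noncomputable def servedPay (pay : (Fin n → Fin m → ℝ) → Fin n × Fin m → ℝ) (e : Fin n × Fin m)
    (s : (Fin n × Fin m → ℝ) × Fin 3) : ℝ :=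
  if s.2 = 0 then pay (absMatrix s.1) e else 0

open Classical in
/-- The indicator of `Served`. -/
noncomputable def servedInd (X : (Fin n → Fin m → ℝ) → Finset (Fin n × Fin m)) (e : Fin n × Fin m)
    (s : (Fin n × Fin m → ℝ) × Fin 3) : ℝ :=
  if Served X e s then 1 else 0

/-- Sampled values whose `e`-th entry is replaced by `t`. -/
def resample (ω : Fin n × Fin m → (Fin n × Fin m → ℝ) × Fin 3) (e : Fin n × Fin m) (t : ℝ) :
    (Fin n × Fin m → ℝ) × Fin 3 :=
  (Function.update (ω e).1 e t, (ω e).2)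

lemma measurable_resample (ω : Fin n × Fin m → (Fin n × Fin m → ℝ) × Fin 3) (e : Fin n × Fin m) :
    Measurable (resample ω e) :=
  (measurable_update _).prodMk measurable_const

variable {X : (Fin n → Fin m → ℝ) → Finset (Fin n × Fin m)}
  {pay : (Fin n → Fin m → ℝ) → Fin n × Fin m → ℝ}

lemma IsCopiesMech.pay_le (h : IsCopiesMech n m k X pay) {v : Fin n → Fin m → ℝ}
    (hv : ∀ i j, 0 ≤ v i j) (e : Fin n × Fin m) : pay v e ≤ v e.1 e.2 := by
  have := h.ir v hv e
  have := hv e.1 e.2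
  split_ifs at * <;> linarith

lemma IsCopiesMech.pay_eq_zero (h : IsCopiesMech n m k X pay) {v : Fin n → Fin m → ℝ}
    (hv : ∀ i j, 0 ≤ v i j) {e : Fin n × Fin m} (he : e ∉ X v) : pay v e = 0 := by
  have h1 := h.ir v hv e
  have h2 := h.pay_nonneg v e
  rw [if_neg he] at h1
  linarith

lemma IsCopiesMech.measurableSet_mem (h : IsCopiesMech n m k X pay) (e : Fin n × Fin m) :
    MeasurableSet {v | e ∈ X v} := by
  have : {v | e ∈ X v} = ⋃ S ∈ {S : Finset (Fin n × Fin m) | e ∈ S}, {v | X v = S} := by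
    ext v; simp
  rw [this]
  exact MeasurableSet.biUnion (Set.to_countable _) fun S _ => h.measX S

lemma IsCopiesMech.measurableSet_served (h : IsCopiesMech n m k X pay) (e : Fin n × Fin m) :
    MeasurableSet {s | Served X e s} :=
  (measurable_snd (measurableSet_singleton (0 : Fin 3))).inter
    ((measurable_absMatrix.comp measurable_fst) (h.measurableSet_mem e))

lemma IsCopiesMech.measurable_servedPay (h : IsCopiesMech n m k X pay) (e : Fin n × Fin m) :
    Measurable (servedPay pay e) :=
  Measurable.ite (measurable_snd (measurableSet_singleton (0 : Fin 3)))
    ((h.measPay e).comp (measurable_absMatrix.comp measurable_fst)) measurable_const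

lemma IsCopiesMech.measurable_servedInd (h : IsCopiesMech n m k X pay) (e : Fin n × Fin m) :
    Measurable (servedInd X e) :=
  Measurable.ite (h.measurableSet_served e) measurable_const measurable_const

lemma IsCopiesMech.servedPay_nonneg (h : IsCopiesMech n m k X pay) (e : Fin n × Fin m)
    (s : (Fin n × Fin m → ℝ) × Fin 3) : 0 ≤ servedPay pay e s := by
  rw [servedPay]
  split_ifs
  · exact h.pay_nonneg _ _
  · exact le_rfl

/-- Running the copies mechanism for each pair against its own resampled rivals gives a menu. -/
lemma IsCopiesMech.isMenu (h : IsCopiesMech n m k X pay)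
    (ω : Fin n × Fin m → (Fin n × Fin m → ℝ) × Fin 3) :
    IsMenu (fun e t => Served X e (resample ω e t))
      (fun e t => servedPay pay e (resample ω e t)) where
  measAcc e := measurable_resample ω e (h.measurableSet_served e)
  measPay e := (h.measurable_servedPay e).comp (measurable_resample ω e)
  nonneg e t := h.servedPay_nonneg e _
  ic e t t' ht ht' := by
    rintro ⟨hc, h1⟩ ⟨-, h2⟩
    have := h.ic _ (absMatrix_nonneg (Function.update (ω e).1 e t)) e.1 e.2 t' ht'
    rw [updateEntry_absMatrix_update _ _ _ ht', absMatrix_update_apply _ _ ht] at this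
    simpa [servedPay, resample, show (ω e).2 = 0 from hc,
      show e ∈ X (absMatrix (Function.update (ω e).1 e t')) from h1,
      show e ∈ X (absMatrix (Function.update (ω e).1 e t)) from h2] using this
  ic_of_not e t t' ht ht' := by
    rintro ⟨hc, h1⟩ h2
    replace hc : (ω e).2 = 0 := hc
    replace h1 : e ∈ X (absMatrix (Function.update (ω e).1 e t')) := h1
    replace h2 : e ∉ X (absMatrix (Function.update (ω e).1 e t)) := fun h => h2 ⟨hc, h⟩
    have := h.ic _ (absMatrix_nonneg (Function.update (ω e).1 e t)) e.1 e.2 t' ht'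
    rw [updateEntry_absMatrix_update _ _ _ ht', absMatrix_update_apply _ _ ht, if_pos h1,
      if_neg h2, h.pay_eq_zero (absMatrix_nonneg _) h2] at this
    simpa [servedPay, resample, hc] using this
  ir e t ht := by
    rintro ⟨hc, -⟩
    have := h.pay_le (absMatrix_nonneg (Function.update (ω e).1 e t)) e
    rw [absMatrix_update_apply _ _ ht] at this
    simpa [servedPay, resample, show (ω e).2 = 0 from hc] using this
  pay_of_not e t hn := by
    simp only [servedPay]
    split_ifs with hc
    · exact h.pay_eq_zero (absMatrix_nonneg _) fun he => hn ⟨hc, he⟩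
    · rfl

/-- The flat product distribution of the values together with a uniform coin on `Fin 3`. -/
noncomputable def sampleMeasure (F : Fin n → Fin m → Measure ℝ) :
    Measure ((Fin n × Fin m → ℝ) × Fin 3) :=
  (Measure.pi fun e : Fin n × Fin m => F e.1 e.2).prod (uniformOn Set.univ)

instance isProbabilityMeasure_uniformOn_fin_three :
    IsProbabilityMeasure (uniformOn (Set.univ : Set (Fin 3))) :=
  isProbabilityMeasure_uniformOn Set.finite_univ Set.univ_nonempty

variable (F : Fin n → Fin m → Measure ℝ) [∀ i j, IsProbabilityMeasure (F i j)]

instance isProbabilityMeasure_sampleMeasure : IsProbabilityMeasure (sampleMeasure F) := by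
  unfold sampleMeasure; infer_instance

lemma integral_ite_coin_sampleMeasure (f : (Fin n × Fin m → ℝ) → ℝ) :
    ∫ s, (if s.2 = 0 then f s.1 else 0) ∂(sampleMeasure F) =
      (∫ x, f x ∂(Measure.pi fun e : Fin n × Fin m => F e.1 e.2)) / 3 := by
  have hcoin : ∫ c : Fin 3, (if c = 0 then (1 : ℝ) else 0) ∂(uniformOn Set.univ) = 1 / 3 := by
    have : (fun c : Fin 3 => if c = 0 then (1 : ℝ) else 0) =
        Set.indicator {0} (fun _ => (1 : ℝ)) := by
      ext c; simp [Set.indicator]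
    rw [this, integral_indicator_const _ (measurableSet_singleton _), measureReal_def,
      uniformOn_univ]
    simp
  have := integral_prod_mul (μ := Measure.pi fun e : Fin n × Fin m => F e.1 e.2)
    (ν := uniformOn (Set.univ : Set (Fin 3))) f (fun c => if c = 0 then (1 : ℝ) else 0)
  rw [hcoin] at this
  rw [sampleMeasure, div_eq_mul_one_div, ← this]
  congr 1
  ext s
  simp

lemma absMatrix_ae_eq (hF : ∀ i j, F i j (Set.Iio 0) = 0) :
    ∀ᵐ x ∂(Measure.pi fun e : Fin n × Fin m => F e.1 e.2),
      absMatrix x = fun i j => x (i, j) := by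
  have := (measurePreserving_curry F).quasiMeasurePreserving.ae (ae_valMeasure_nonneg F hF)
  filter_upwards [this] with x hx
  funext i j
  exact abs_of_nonneg (hx i j)

lemma IsCopiesMech.integrable_pay (h : IsCopiesMech n m k X pay)
    (hF : ∀ i j, Integrable id (F i j)) (e : Fin n × Fin m) :
    Integrable (fun x => pay (absMatrix x) e)
      (Measure.pi fun e : Fin n × Fin m => F e.1 e.2) := by
  have h1 : Integrable (fun x : Fin n × Fin m → ℝ => |x e|)
      (Measure.pi fun e : Fin n × Fin m => F e.1 e.2) :=
    ((measurePreserving_eval (fun e : Fin n × Fin m => F e.1 e.2) e).integrable_comp_of_integrable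
      (hF e.1 e.2)).abs
  refine h1.mono' ((h.measPay e).comp measurable_absMatrix).aestronglyMeasurable
    (ae_of_all _ fun x => ?_)
  rw [Real.norm_of_nonneg (h.pay_nonneg _ _)]
  exact h.pay_le (absMatrix_nonneg x) e

lemma IsCopiesMech.copiesRevenue_eq (h : IsCopiesMech n m k X pay)
    (hF0 : ∀ i j, F i j (Set.Iio 0) = 0) (hF : ∀ i j, Integrable id (F i j)) :
    copiesRevenue F pay = 3 * ∑ e, ∫ s, servedPay pay e s ∂(sampleMeasure F) := by
  have hp := measurePreserving_curry F
  have hm : Measurable fun v => ∑ e, pay v e := Finset.measurable_sum _ fun e _ => h.measPay e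
  rw [copiesRevenue, ← hp.map_eq, integral_map hp.measurable.aemeasurable hm.aestronglyMeasurable,
    Finset.mul_sum]
  have : ∫ x, ∑ e, pay (fun i j => x (i, j)) e
      ∂(Measure.pi fun e : Fin n × Fin m => F e.1 e.2) =
      ∫ x, ∑ e, pay (absMatrix x) e ∂(Measure.pi fun e : Fin n × Fin m => F e.1 e.2) := by
    refine integral_congr_ae ?_
    filter_upwards [absMatrix_ae_eq F hF0] with x hx
    rw [hx]
  rw [this, integral_finsetSum _ fun e _ => h.integrable_pay F hF e]
  refine Finset.sum_congr rfl fun e _ => ?_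
  simp only [servedPay]
  rw [integral_ite_coin_sampleMeasure F fun x => pay (absMatrix x) e]
  ring

lemma IsCopiesMech.sum_integral_servedInd_le (h : IsCopiesMech n m k X pay)
    {R : Finset (Fin n × Fin m)} {c : ℕ} (hR : ∀ v, (X v ∩ R).card ≤ c) :
    ∑ e ∈ R, ∫ s, servedInd X e s ∂(sampleMeasure F) ≤ c / 3 := by
  have hm : ∀ e, Measurable fun x : Fin n × Fin m → ℝ =>
      if e ∈ X (absMatrix x) then (1 : ℝ) else 0 := fun e =>
    Measurable.ite (measurable_absMatrix (h.measurableSet_mem e)) measurable_const measurable_const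
  have hInt : ∀ e, Integrable (fun x : Fin n × Fin m → ℝ =>
      if e ∈ X (absMatrix x) then (1 : ℝ) else 0)
      (Measure.pi fun e : Fin n × Fin m => F e.1 e.2) := fun e =>
    Integrable.of_bound (hm e).aestronglyMeasurable 1 (ae_of_all _ fun x => by
      split_ifs <;> simp)
  have h1 : ∀ e, ∫ s, servedInd X e s ∂(sampleMeasure F) =
      (∫ x, (if e ∈ X (absMatrix x) then (1 : ℝ) else 0)
        ∂(Measure.pi fun e : Fin n × Fin m => F e.1 e.2)) / 3 := fun e => by
    rw [← integral_ite_coin_sampleMeasure]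
    congr 1
    ext s
    by_cases hc : s.2 = 0 <;> by_cases he : e ∈ X (absMatrix s.1) <;>
      simp [servedInd, Served, hc, he]
  simp only [h1]
  rw [← Finset.sum_div, ← integral_finsetSum _ fun e _ => hInt e]
  gcongr
  calc _ ≤ ∫ _, (c : ℝ) ∂(Measure.pi fun e : Fin n × Fin m => F e.1 e.2) := by
        refine integral_mono (integrable_finsetSum _ fun e _ => hInt e) (integrable_const _)
          fun x => ?_
        dsimp only
        rw [Finset.sum_boole, Finset.filter_mem_eq_inter, Finset.inter_comm]
        exact_mod_cast hR _
    _ = c := by simp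

lemma IsCopiesMech.card_inter_rowRivals_le (h : IsCopiesMech n m k X pay)
    (v : Fin n → Fin m → ℝ) (e : Fin n × Fin m) : (X v ∩ rowRivals e).card ≤ 1 := by
  refine (Finset.card_le_card fun e' he' => ?_).trans ((h.feas v).1 e.1)
  simp only [rowRivals, Finset.mem_inter, Finset.mem_filter] at he' ⊢
  exact ⟨he'.1, he'.2.2.1⟩

lemma IsCopiesMech.card_inter_colRivals_le (h : IsCopiesMech n m k X pay)
    (v : Fin n → Fin m → ℝ) (e : Fin n × Fin m) : (X v ∩ colRivals e).card ≤ k e.2 := by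
  refine (Finset.card_le_card fun e' he' => ?_).trans ((h.feas v).2 e.2)
  simp only [colRivals, Finset.mem_inter, Finset.mem_filter] at he' ⊢
  exact ⟨he'.1, he'.2.2.1⟩

lemma servedInd_nonneg (e : Fin n × Fin m) (s : (Fin n × Fin m → ℝ) × Fin 3) :
    0 ≤ servedInd X e s := by
  rw [servedInd]; split_ifs <;> simp

lemma servedInd_le_one (e : Fin n × Fin m) (s : (Fin n × Fin m → ℝ) × Fin 3) :
    servedInd X e s ≤ 1 := by
  rw [servedInd]; split_ifs <;> simp

/-- The price of `e` counted when no row rival is served and capacity is left over by the column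
rivals. -/
noncomputable def freePay (k : Fin m → ℕ) (X : (Fin n → Fin m → ℝ) → Finset (Fin n × Fin m))
    (pay : (Fin n → Fin m → ℝ) → Fin n × Fin m → ℝ) (e : Fin n × Fin m)
    (ω : Fin n × Fin m → (Fin n × Fin m → ℝ) × Fin 3) : ℝ :=
  servedPay pay e (ω e) * ((if ∑ e' ∈ rowRivals e, servedInd X e' (ω e') < 1 then 1 else 0) *
    (if ∑ e' ∈ colRivals e, servedInd X e' (ω e') < k e.2 then 1 else 0))

lemma IsCopiesMech.freePay_nonneg (h : IsCopiesMech n m k X pay) (e : Fin n × Fin m)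
    (ω : Fin n × Fin m → (Fin n × Fin m → ℝ) × Fin 3) : 0 ≤ freePay k X pay e ω := by
  refine mul_nonneg (h.servedPay_nonneg _ _) (mul_nonneg ?_ ?_) <;> split_ifs <;> simp

lemma IsCopiesMech.freePay_le (h : IsCopiesMech n m k X pay) (e : Fin n × Fin m)
    (ω : Fin n × Fin m → (Fin n × Fin m → ℝ) × Fin 3) :
    freePay k X pay e ω ≤ servedPay pay e (ω e) := by
  have := h.servedPay_nonneg e (ω e)
  rw [freePay]
  split_ifs <;> simp [this]

lemma IsCopiesMech.measurable_freePay (h : IsCopiesMech n m k X pay) (e : Fin n × Fin m) :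
    Measurable (freePay k X pay e) := by
  have hs : ∀ R : Finset (Fin n × Fin m),
      Measurable fun ω : Fin n × Fin m → (Fin n × Fin m → ℝ) × Fin 3 =>
        ∑ e' ∈ R, servedInd X e' (ω e') := fun R =>
    Finset.measurable_sum _ fun e' _ => (h.measurable_servedInd e').comp (measurable_pi_apply e')
  exact ((h.measurable_servedPay e).comp (measurable_pi_apply e)).mul
    ((Measurable.ite (measurableSet_lt (hs _) measurable_const) measurable_const
      measurable_const).mul
    (Measurable.ite (measurableSet_lt (hs _) measurable_const) measurable_const
      measurable_const))

lemma IsCopiesMech.integrable_freePay (h : IsCopiesMech n m k X pay)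
    (hF : ∀ i j, Integrable id (F i j)) (e : Fin n × Fin m) :
    Integrable (freePay k X pay e) (Measure.pi fun _ : Fin n × Fin m => sampleMeasure F) := by
  have h1 : Integrable (servedPay pay e) (sampleMeasure F) := by
    refine Integrable.mono'
      ((measurePreserving_fst (μ := Measure.pi fun e : Fin n × Fin m => F e.1 e.2)
        (ν := uniformOn (Set.univ : Set (Fin 3)))).integrable_comp_of_integrable
        (h.integrable_pay F hF e)) (h.measurable_servedPay e).aestronglyMeasurable
      (ae_of_all _ fun s => ?_)
    rw [Real.norm_of_nonneg (h.servedPay_nonneg _ _), servedPay]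
    split_ifs
    · exact le_rfl
    · exact h.pay_nonneg _ _
  refine ((measurePreserving_eval (fun _ : Fin n × Fin m => sampleMeasure F)
    e).integrable_comp_of_integrable h1).mono' (h.measurable_freePay e).aestronglyMeasurable
    (ae_of_all _ fun ω => ?_)
  rw [Real.norm_of_nonneg (h.freePay_nonneg _ _)]
  exact h.freePay_le e ω

lemma IsCopiesMech.four_ninths_mul_le_integral_freePay (h : IsCopiesMech n m k X pay)
    (hk : ∀ j, 1 ≤ k j) (e : Fin n × Fin m) :
    (4 / 9) * ∫ s, servedPay pay e s ∂(sampleMeasure F) ≤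
      ∫ ω, freePay k X pay e ω ∂(Measure.pi fun _ : Fin n × Fin m => sampleMeasure F) := by
  have hφ : ∀ c : ℝ, Measurable fun t : ℝ => if t < c then (1 : ℝ) else 0 := fun c =>
    Measurable.ite measurableSet_Iio measurable_const measurable_const
  have hdis : Disjoint (rowRivals e) (colRivals e) := by
    rw [Finset.disjoint_left]
    intro e' h1 h2
    simp only [rowRivals, colRivals, Finset.mem_filter] at h1 h2
    exact h1.2.2 h2.2.1
  have key := integral_mul_of_disjoint_blocks (fun _ : Fin n × Fin m => sampleMeasure F)
    h.measurable_servedInd (h.measurable_servedPay e) (hφ 1) (hφ (k e.2)) (e := e)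
    (by simp [rowRivals]) (by simp [colRivals]) hdis
  have hrow := two_thirds_le_integral_sum_lt (fun _ : Fin n × Fin m => sampleMeasure F)
    h.measurable_servedInd servedInd_nonneg servedInd_le_one (S := rowRivals e) one_pos
    (by simpa using h.sum_integral_servedInd_le F (c := 1) fun v => h.card_inter_rowRivals_le v e)
  have hcol := two_thirds_le_integral_sum_lt (fun _ : Fin n × Fin m => sampleMeasure F)
    h.measurable_servedInd servedInd_nonneg servedInd_le_one (S := colRivals e)
    (c := (k e.2 : ℝ)) (by exact_mod_cast hk e.2)
    (h.sum_integral_servedInd_le F fun v => h.card_inter_colRivals_le v e)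
  have h0 : 0 ≤ ∫ s, servedPay pay e s ∂(sampleMeasure F) :=
    integral_nonneg (h.servedPay_nonneg e)
  simp only [freePay]
  rw [key, mul_comm]
  refine mul_le_mul_of_nonneg_left ?_ h0
  nlinarith [mul_nonneg (sub_nonneg.2 hrow) (sub_nonneg.2 hcol)]

/-- Some resampling outcome yields a menu whose expected revenue is at least the average. -/
lemma IsCopiesMech.exists_integral_le_detRevenue (h : IsCopiesMech n m k X pay)
    (hF0 : ∀ i j, F i j (Set.Iio 0) = 0) (hF : ∀ i j, Integrable id (F i j)) :
    ∃ ω : Fin n × Fin m → (Fin n × Fin m → ℝ) × Fin 3,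
      ∫ z, ∑ e, freePay k X pay e z ∂(Measure.pi fun _ : Fin n × Fin m => sampleMeasure F) ≤
        detRevenue F (menuPay k (fun e t => Served X e (resample ω e t))
          (fun e t => servedPay pay e (resample ω e t))) := by
  classical
  set μ := Measure.pi fun e : Fin n × Fin m => F e.1 e.2
  set P := Measure.pi fun _ : Fin n × Fin m => sampleMeasure F
  have hΦ : MeasurePreserving (fun (z : (Fin n × Fin m → ℝ) ×
      (Fin n × Fin m → (Fin n × Fin m → ℝ) × Fin 3)) e => resample z.2 e (z.1 e))
      (μ.prod P) P :=
    measurePreserving_resample (fun e : Fin n × Fin m => F e.1 e.2)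
      (uniformOn (Set.univ : Set (Fin 3)))
  have hG : Integrable (fun z => ∑ e, freePay k X pay e z) P :=
    integrable_finsetSum _ fun e _ => h.integrable_freePay F hF e
  have hGΦ : Integrable (fun z => ∑ e, freePay k X pay e fun e => resample z.2 e (z.1 e))
    (μ.prod P) := hΦ.integrable_comp_of_integrable hG
  obtain ⟨ω, hω⟩ := exists_integral_le hGΦ.integral_prod_right
  refine ⟨ω, ?_⟩
  have hmenu := h.isMenu ω
  have hp := measurePreserving_curry F
  have hdet := (hmenu.isDetMech (k := k)).integrable hF0 hF
  calc ∫ z, ∑ e, freePay k X pay e z ∂P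
      = ∫ z, ∑ e, freePay k X pay e (fun e => resample z.2 e (z.1 e)) ∂(μ.prod P) := by
        conv_lhs => rw [← hΦ.map_eq]
        refine integral_map hΦ.measurable.aemeasurable ?_
        exact (Finset.measurable_sum _ fun e _ => h.measurable_freePay e).aestronglyMeasurable
    _ = ∫ ω, ∫ x, ∑ e, freePay k X pay e (fun e => resample ω e (x e)) ∂μ ∂P :=
        integral_prod_symm (μ := μ) (ν := P) _ hGΦ
    _ ≤ ∫ x, ∑ e, freePay k X pay e (fun e => resample ω e (x e)) ∂μ := hω
    _ ≤ ∫ x, ∑ i, menuPay k (fun e t => Served X e (resample ω e t))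
          (fun e t => servedPay pay e (resample ω e t)) (fun i j => x (i, j)) i ∂μ := by
        refine integral_mono_of_nonneg
          (ae_of_all _ fun x => Finset.sum_nonneg fun e _ => h.freePay_nonneg e _)
          (hp.integrable_comp_of_integrable hdet) (ae_of_all _ fun x => ?_)
        exact sum_price_mul_le_sum_menuPay hmenu fun i j => x (i, j)
    _ = _ := by
        rw [detRevenue, ← hp.map_eq]
        symm
        refine integral_map hp.measurable.aemeasurable ?_
        exact (Finset.measurable_sum _ fun i _ => measurable_menuPay hmenu i).aestronglyMeasurable

end Resampling

/-- For `n` unit-demand agents, `m` items with capacities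
`k j ≥ 1`, and independent values `v i j ∼ F i j` (Borel distributions on
`ℝ≥0` with finite mean), the supremum of expected revenue over IC, IR
deterministic mechanisms for the multi-agent unit-demand instance is at least
`4/27` times the expected revenue of every IC, IR deterministic mechanism for
the copies instance. -/
theorem detSup_ge_four_27_copies
    {n m : ℕ} (k : Fin m → ℕ) (hk : ∀ j, 1 ≤ k j)
    (F : Fin n → Fin m → Measure ℝ) [∀ i j, IsProbabilityMeasure (F i j)]
    (hF_nonneg : ∀ i j, F i j (Set.Iio 0) = 0)
    (hF_mean : ∀ i j, Integrable id (F i j))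
    (X : (Fin n → Fin m → ℝ) → Finset (Fin n × Fin m))
    (pay : (Fin n → Fin m → ℝ) → Fin n × Fin m → ℝ)
    (hmech : IsCopiesMech n m k X pay) :
    (4 / 27) * copiesRevenue F pay ≤
      sSup {r : ℝ | ∃ (X' : (Fin n → Fin m → ℝ) → Finset (Fin n × Fin m))
        (pay' : (Fin n → Fin m → ℝ) → Fin n → ℝ),
        IsDetMech n m k X' pay' ∧ r = detRevenue F pay'} := by
  obtain ⟨ω, hω⟩ := hmech.exists_integral_le_detRevenue F hF_nonneg hF_mean
  refine le_trans ?_ (hω.trans (le_csSup (bddAbove_detRevenue hF_nonneg hF_mean)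
    ⟨_, _, (hmech.isMenu ω).isDetMech, rfl⟩))
  rw [hmech.copiesRevenue_eq F hF_nonneg hF_mean,
    integral_finsetSum _ fun e _ => hmech.integrable_freePay F hF_mean e, ← mul_assoc,
    Finset.mul_sum]
  refine Finset.sum_le_sum fun e _ => ?_
  have := hmech.four_ninths_mul_le_integral_freePay F hk e
  linarith
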